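/- arXiv:2501.18066 — 7 statements merged into one kernel-verified Lean document; each statement's English description precedes it below -/
import Mathlib

section
/- Let n ≥ 1 and 0 ≤ k ≤ n. For every binary sequence s ∈ {0,1}^n with exactly k ones, there exists t ∈ ℤ/nℤ such that the cyclic rotation s·t is a path. In other words, the orbit of s under cyclic rotation contains at least one path. -/
/-- A binary sequence `s : ZMod n → Bool` (viewed as `(s_0, …, s_{n-1})`) of weight `k`
is a *path* if for every `j` with `0 ≤ j ≤ n` we have
`n * (s_0 + ⋯ + s_{j-1}) ≥ k * j`. -/
def IsPath (n k : ℕ) [NeZero n] (s : ZMod n → Bool) : Prop :=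
  ∀ j ≤ n,
    k * j ≤ n * (Finset.univ.filter (fun l : ZMod n => l.val < j ∧ s l = true)).card

/-- Counting the ones of `s` among the residues below `j ≤ n` amounts to counting them along the
natural numbers below `j`. -/
theorem card_filter_val_lt_eq_count {n : ℕ} [NeZero n] (s : ZMod n → Bool) {j : ℕ} (hj : j ≤ n) :
    (Finset.univ.filter (fun l : ZMod n => l.val < j ∧ s l = true)).card =
      Nat.count (fun i : ℕ => s (i : ZMod n) = true) j := by
  rw [Nat.count_eq_card_filter_range]
  refine Finset.card_bij (fun l _ => l.val) ?_ ?_ ?_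
  · intro l hl
    simpa using hl
  · intro a _ b _ h
    exact ZMod.val_injective n h
  · intro i hi
    simp only [Finset.mem_filter, Finset.mem_range] at hi
    have hv : (i : ZMod n).val = i := ZMod.val_cast_of_lt (hi.1.trans_le hj)
    exact ⟨(i : ZMod n), by simpa [hv] using hi, hv⟩

/-- Every binary sequence of length `n ≥ 1` with exactly `k` ones has a cyclic rotation
`l ↦ s (l + t)` that is a path. -/
theorem orbit_contains_path (n k : ℕ) [NeZero n] (hk : k ≤ n)
    (s : ZMod n → Bool)
    (hs : (Finset.univ.filter (fun l : ZMod n => s l = true)).card = k) :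
    ∃ t : ZMod n, IsPath n k (fun l => s (l + t)) := by
  set p : ℕ → Prop := fun i => s (i : ZMod n) = true with hp
  have hn : 0 < n := NeZero.pos n
  have hcount : Nat.count p n = k := by
    rw [← hs, ← card_filter_val_lt_eq_count s le_rfl]
    simp [ZMod.val_lt]
  let f : ℕ → ℤ := fun m => n * Nat.count p m - k * m
  have hper : Function.Periodic f n := by
    intro m
    have hshift : (fun i => p (n + i)) = p := by
      funext i
      simp [hp]
    have h : Nat.count p (m + n) = k + Nat.count p m := by
      rw [add_comm m n, Nat.count_add, hcount]
      simp only [hshift]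
    simp only [f, h]
    push_cast
    ring
  obtain ⟨m, -, hm⟩ := (Finset.range n).exists_min_image f ⟨0, by simpa using hn⟩
  refine ⟨(m : ZMod n), fun j hj => ?_⟩
  rw [card_filter_val_lt_eq_count _ hj]
  have hle : f m ≤ f (m + j) := by
    rw [← hper.map_mod_nat (m + j)]
    exact hm _ (Finset.mem_range.2 (Nat.mod_lt _ hn))
  have hrot : (fun i => p (m + i)) = fun i : ℕ => s ((i : ZMod n) + m) = true := by
    funext i
    simp [hp, add_comm]
  simp only [f, Nat.count_add, hrot] at hle
  push_cast at hle
  zify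
  linarith
end

section
/- Let n ≥ 1 and 0 ≤ k ≤ n with gcd(n, k) = 1. For every binary sequence s ∈ {0,1}^n with exactly k ones, there exists a UNIQUE t ∈ ℤ/nℤ such that the cyclic rotation s·t is a path. In other words, the orbit of s under cyclic rotation contains exactly one path. -/
/-- The height after `m` steps of the periodic walk on `ℤ` that moves by `n - k` at each one of `s`
and by `-k` at each zero. -/
def cyclicHeight {n : ℕ} (k : ℕ) (s : ZMod n → Bool) (m : ℕ) : ℤ :=
  ∑ i ∈ Finset.range m, ((if s i = true then (n : ℤ) else 0) - k)

theorem card_filter_val_lt_eq_sum {n : ℕ} [NeZero n] (s : ZMod n → Bool) {j : ℕ} (hj : j ≤ n) :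
    (Finset.univ.filter (fun l : ZMod n => l.val < j ∧ s l = true)).card =
      ∑ i ∈ Finset.range j, if s i = true then 1 else 0 := by
  rw [← Finset.card_filter]
  refine Finset.card_bij (fun l _ => l.val) ?_ ?_ ?_
  · intro l hl
    simpa using hl
  · intro a _ b _ h
    exact ZMod.val_injective n h
  · intro i hi
    simp only [Finset.mem_filter, Finset.mem_range] at hi
    have hv : (i : ZMod n).val = i := ZMod.val_cast_of_lt (by omega)
    exact ⟨i, by simp [hv, hi], hv⟩

theorem cyclicHeight_eq_card {n : ℕ} [NeZero n] (k : ℕ) (s : ZMod n → Bool) {j : ℕ} (hj : j ≤ n) :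
    cyclicHeight k s j =
      n * (Finset.univ.filter (fun l : ZMod n => l.val < j ∧ s l = true)).card - k * j := by
  rw [card_filter_val_lt_eq_sum s hj, cyclicHeight, Finset.sum_sub_distrib]
  simp [← Finset.sum_filter, mul_comm]

theorem cyclicHeight_add {n : ℕ} (k : ℕ) (s : ZMod n → Bool) (a b : ℕ) :
    cyclicHeight k s (a + b) = cyclicHeight k s a + cyclicHeight k (fun l => s (l + (a : ZMod n))) b := by
  simp only [cyclicHeight, Finset.sum_range_add, Nat.cast_add, add_comm (a : ZMod n)]

theorem isPath_iff_forall_cyclicHeight_nonneg {n : ℕ} [NeZero n] (k : ℕ) (s : ZMod n → Bool) :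
    IsPath n k s ↔ ∀ j ≤ n, 0 ≤ cyclicHeight k s j := by
  refine forall₂_congr fun j hj => ?_
  rw [cyclicHeight_eq_card k s hj, sub_nonneg]
  norm_cast

theorem cyclicHeight_periodic {n k : ℕ} [NeZero n] {s : ZMod n → Bool}
    (hs : (Finset.univ.filter (fun l : ZMod n => s l = true)).card = k) :
    Function.Periodic (cyclicHeight k s) n := by
  intro m
  have h : cyclicHeight k s n = 0 := by
    rw [cyclicHeight_eq_card k s le_rfl]
    simp [ZMod.val_lt, hs, mul_comm]
  rw [add_comm, cyclicHeight_add, h]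
  simp

theorem intCast_cyclicHeight {n : ℕ} (k : ℕ) (s : ZMod n → Bool) (m : ℕ) :
    (cyclicHeight k s m : ZMod n) = -(m * k) := by
  simp [cyclicHeight, apply_ite (Int.cast : ℤ → ZMod n)]

theorem isPath_rotate_iff {n k : ℕ} [NeZero n] {s : ZMod n → Bool}
    (hs : (Finset.univ.filter (fun l : ZMod n => s l = true)).card = k) (t : ZMod n) :
    IsPath n k (fun l => s (l + t)) ↔ ∀ m, cyclicHeight k s t.val ≤ cyclicHeight k s m := by
  have hadd (j : ℕ) := cyclicHeight_add k s t.val j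
  simp only [ZMod.natCast_zmod_val] at hadd
  rw [isPath_iff_forall_cyclicHeight_nonneg]
  refine ⟨fun h m => ?_, fun h j _ => by linarith [hadd j, h (t.val + j)]⟩
  have hper := cyclicHeight_periodic hs
  have hm : m % n < n := Nat.mod_lt _ (NeZero.pos n)
  have ht := ZMod.val_lt t
  rw [← hper.map_mod_nat m]
  rcases le_total t.val (m % n) with hle | hle
  · have := hadd (m % n - t.val)
    rw [Nat.add_sub_cancel' hle] at this
    linarith [h (m % n - t.val) (by omega)]
  · have := hadd (m % n + n - t.val)
    rw [Nat.add_sub_cancel' (by omega), hper] at this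
    linarith [h (m % n + n - t.val) (by omega)]

/-- If `gcd(n, k) = 1`, every binary sequence of length `n ≥ 1` with exactly `k` ones has a
unique cyclic rotation `l ↦ s (l + t)` that is a path. -/
theorem orbit_contains_unique_path (n k : ℕ) [NeZero n] (hk : k ≤ n)
    (hcop : Nat.gcd n k = 1) (s : ZMod n → Bool)
    (hs : (Finset.univ.filter (fun l : ZMod n => s l = true)).card = k) :
    ∃! t : ZMod n, IsPath n k (fun l => s (l + t)) := by
  simp only [isPath_rotate_iff hs]
  obtain ⟨t, -, ht⟩ := Finset.exists_min_image Finset.univ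
    (fun t : ZMod n => cyclicHeight k s t.val) Finset.univ_nonempty
  have hmin : ∀ m, cyclicHeight k s t.val ≤ cyclicHeight k s m := fun m => by
    rw [← (cyclicHeight_periodic hs).map_mod_nat m, ← ZMod.val_natCast]
    exact ht m (Finset.mem_univ _)
  refine ⟨t, hmin, fun u hu => ?_⟩
  have heq := congrArg (Int.cast : ℤ → ZMod n) (le_antisymm (hu t.val) (hmin u.val))
  simp only [intCast_cyclicHeight, ZMod.natCast_zmod_val, neg_inj] at heq
  exact ((ZMod.isUnit_iff_coprime k n).mpr (Nat.Coprime.symm hcop)).mul_left_injective heq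
end

section
/- Let n ≥ 1, let 0 ≤ k ≤ n, let x ≥ 0, and let i be an integer with gcd(i, n) = 1. Then the number of k-element subsets A of ℤ/nℤ with d_i(A) = x equals the number of k-element subsets A of ℤ/nℤ with d_1(A) = x. (The distribution of the number of incidences at distance i does not depend on i when i is coprime to n.) -/
/-- The number of incidences of `A ⊆ ℤ/nℤ` at distance `i`:
`d_i(A) = |{x ∈ A : x + i ∈ A}|`. -/
def inc (n : ℕ) (i : ℤ) (A : Finset (ZMod n)) : ℕ :=
  (A.filter (fun x => x + (i : ZMod n) ∈ A)).card

/-- Multiplying a set by a unit `u` of `ℤ/nℤ` turns incidences at distance `1` into incidences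
at distance `u`. -/
theorem inc_map_mulLeft (n : ℕ) (i : ℤ) (u : (ZMod n)ˣ) (hu : (u : ZMod n) = i)
    (A : Finset (ZMod n)) :
    inc n i (A.map u.mulLeft.toEmbedding) = inc n 1 A := by
  unfold inc
  rw [Finset.filter_map, Finset.card_map]
  congr 1
  refine Finset.filter_congr fun y _ => ?_
  have h : u.mulLeft y + (i : ZMod n) = u.mulLeft (y + ((1 : ℤ) : ZMod n)) := by
    simp [← hu, mul_add]
  simp only [Function.comp_apply, Equiv.coe_toEmbedding, h, Finset.mem_map_equiv,
    Equiv.symm_apply_apply]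

/-- If `gcd(i, n) = 1`, the number of `k`-subsets of `ℤ/nℤ` with `x` incidences at
distance `i` equals the number with `x` incidences at distance `1`. -/
theorem count_dist_i_eq_count_dist_one (n : ℕ) [NeZero n] (k x : ℕ) (hk : k ≤ n)
    (i : ℤ) (hi : Int.gcd i n = 1) :
    (Finset.univ.filter (fun A : Finset (ZMod n) => A.card = k ∧ inc n i A = x)).card =
    (Finset.univ.filter (fun A : Finset (ZMod n) => A.card = k ∧ inc n 1 A = x)).card := by
  obtain ⟨u, hu⟩ : IsUnit (i : ZMod n) :=
    (ZMod.coe_int_isUnit_iff_isCoprime i n).2 (Int.isCoprime_iff_gcd_eq_one.2 hi).symm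
  symm
  refine Finset.card_equiv u.mulLeft.finsetCongr fun A => ?_
  simp [inc_map_mulLeft n i u hu]
end

section
/- Let n ≥ 3, let 1 ≤ k with 2k ≤ n, let i be an integer with gcd(i, n) = 1, and let 0 ≤ x ≤ k−1. Then (k − x) · |{A ⊆ ℤ/nℤ : |A| = k and d_i(A) = x}| = n · C(k−1, k−x−1) · C(n−k−1, k−x−1), where C(·,·) denotes the binomial coefficient. -/
/-- The number of adjacent pairs `t, t + 1` contained in a set of natural numbers. -/
def adjacentPairs (B : Finset ℕ) : ℕ :=
  (B.filter (fun t => t + 1 ∈ B)).card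

lemma adjacentPairs_le_card (B : Finset ℕ) : adjacentPairs B ≤ B.card :=
  Finset.card_filter_le _ _

lemma adjacentPairs_insert {m : ℕ} {B : Finset ℕ} (hB : B ⊆ Finset.range (m + 1)) :
    adjacentPairs (insert (m + 1) B) = adjacentPairs B + if m ∈ B then 1 else 0 := by
  have hlt : ∀ t ∈ B, t < m + 1 := fun t ht => Finset.mem_range.1 (hB ht)
  unfold adjacentPairs
  split_ifs with h
  · have : (insert (m + 1) B).filter (fun t => t + 1 ∈ insert (m + 1) B) =
        insert m (B.filter (fun t => t + 1 ∈ B)) := by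
      ext t
      have := hlt t
      have := hlt (t + 1)
      have := hlt (t + 1 + 1)
      simp only [Finset.mem_filter, Finset.mem_insert]
      grind
    rw [this, Finset.card_insert_of_notMem]
    have := hlt (m + 1)
    simp only [Finset.mem_filter]
    grind
  · congr 1
    ext t
    have := hlt t
    have := hlt (t + 1)
    have := hlt (t + 1 + 1)
    simp only [Finset.mem_filter, Finset.mem_insert]
    grind

/-- The subsets of `{0, …, m}` that contain `0`, have `k` elements forming `r` maximal runs, and
contain `m` or not according to `p`. -/
def runSets (p : Prop) [Decidable p] (m k r : ℕ) : Finset (Finset ℕ) :=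
  (Finset.range (m + 1)).powerset.filter
    (fun B => 0 ∈ B ∧ (m ∈ B ↔ p) ∧ B.card = k ∧ adjacentPairs B + r = k)

lemma mem_runSets {p : Prop} [Decidable p] {m k r : ℕ} {B : Finset ℕ} :
    B ∈ runSets p m k r ↔ B ⊆ Finset.range (m + 1) ∧
      0 ∈ B ∧ (m ∈ B ↔ p) ∧ B.card = k ∧ adjacentPairs B + r = k := by
  simp [runSets]

lemma runSets_zero_card (p : Prop) [Decidable p] (m r : ℕ) : runSets p m 0 r = ∅ := by
  ext B
  rw [mem_runSets]
  simp only [Finset.card_eq_zero, Finset.notMem_empty, iff_false]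
  rintro ⟨-, h, -, rfl, -⟩
  simp at h

lemma card_runSets_false_succ (m k r : ℕ) :
    (runSets False (m + 1) k r).card =
      (runSets False m k r).card + (runSets True m k r).card := by
  rw [← Finset.card_union_of_disjoint]
  · congr 1
    ext B
    simp only [Finset.mem_union, mem_runSets, Finset.range_add_one (n := m + 1)]
    by_cases h : m + 1 ∈ B
    · have : ¬ B ⊆ Finset.range (m + 1) := fun hB => by simpa using hB h
      tauto
    · rw [Finset.subset_insert_iff_of_notMem h]
      tauto
  · rw [Finset.disjoint_left]
    intro B
    simp only [mem_runSets]
    tauto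

lemma card_runSets_true_succ (m k r : ℕ) :
    (runSets True (m + 1) (k + 1) r).card =
      (if r = 0 then 0 else (runSets False m k (r - 1)).card) + (runSets True m k r).card := by
  have hnot : ∀ B ⊆ Finset.range (m + 1), m + 1 ∉ B := fun B hB h => by simpa using hB h
  have hfalse : (if r = 0 then 0 else (runSets False m k (r - 1)).card) =
      (if r = 0 then ∅ else runSets False m k (r - 1)).card := by
    split_ifs <;> simp
  have key : runSets True (m + 1) (k + 1) r =
      ((if r = 0 then ∅ else runSets False m k (r - 1)) ∪ runSets True m k r).image
        (insert (m + 1)) := by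
    ext A
    simp only [Finset.mem_image, Finset.mem_union]
    constructor
    · intro hA
      obtain ⟨h1, h2, h3, h4, h5⟩ := mem_runSets.1 hA
      have hm : m + 1 ∈ A := h3.2 trivial
      refine ⟨A.erase (m + 1), ?_, Finset.insert_erase hm⟩
      have hs : A.erase (m + 1) ⊆ Finset.range (m + 1) := by
        rwa [← Finset.subset_insert_iff, ← Finset.range_add_one]
      have ha := adjacentPairs_insert hs
      rw [Finset.insert_erase hm] at ha
      have hc := Finset.card_erase_of_mem hm
      have hle := adjacentPairs_le_card (A.erase (m + 1))
      have h0 : 0 ∈ A.erase (m + 1) := Finset.mem_erase.2 ⟨by omega, h2⟩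
      by_cases hmA : m ∈ A.erase (m + 1)
      · right
        rw [if_pos hmA] at ha
        exact mem_runSets.2 ⟨hs, h0, by simpa using hmA, by omega, by omega⟩
      · left
        rw [if_neg hmA] at ha
        rw [if_neg (by omega)]
        exact mem_runSets.2 ⟨hs, h0, by simpa using hmA, by omega, by omega⟩
    · rintro ⟨B, hB, rfl⟩
      have aux : B ⊆ Finset.range (m + 1) ∧ 0 ∈ B ∧ B.card = k ∧
          adjacentPairs (insert (m + 1) B) + r = k + 1 := by
        rcases hB with hB | hB
        · split_ifs at hB with hr
          · simp at hB
          · obtain ⟨h1, h2, h3, h4, h5⟩ := mem_runSets.1 hB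
            rw [adjacentPairs_insert h1, if_neg (by tauto)]
            exact ⟨h1, h2, h4, by omega⟩
        · obtain ⟨h1, h2, h3, h4, h5⟩ := mem_runSets.1 hB
          rw [adjacentPairs_insert h1, if_pos (by tauto)]
          exact ⟨h1, h2, h4, by omega⟩
      obtain ⟨h1, h2, h3, h4⟩ := aux
      refine mem_runSets.2 ⟨?_, Finset.mem_insert_of_mem h2, by simp, ?_, h4⟩
      · rw [Finset.range_add_one (n := m + 1)]
        exact Finset.insert_subset_insert _ h1
      · rw [Finset.card_insert_of_notMem (hnot B h1), h3]
  have hsub : ∀ B ∈ (if r = 0 then ∅ else runSets False m k (r - 1)) ∪ runSets True m k r,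
      m + 1 ∉ B := by
    intro B hB
    rcases Finset.mem_union.1 hB with hB | hB
    · split_ifs at hB with hr
      · simp at hB
      · exact hnot B (mem_runSets.1 hB).1
    · exact hnot B (mem_runSets.1 hB).1
  rw [key, Finset.card_image_of_injOn, Finset.card_union_of_disjoint, hfalse]
  · rw [Finset.disjoint_left]
    intro B hB hB'
    split_ifs at hB with hr
    · simp at hB
    · rw [mem_runSets] at hB hB'
      tauto
  · intro B hB C hC h
    have := congrArg (fun D => D.erase (m + 1)) h
    simpa [Finset.erase_insert (hsub B hB), Finset.erase_insert (hsub C hC)] using this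

lemma card_runSets (m : ℕ) : ∀ k r : ℕ,
    (runSets False m k r).card =
      (if 1 ≤ k ∧ k ≤ m ∧ 1 ≤ r then (k - 1).choose (r - 1) * (m - k).choose (r - 1) else 0) ∧
    (runSets True m k r).card =
      (if k = m + 1 then (if r = 1 then 1 else 0)
        else if 1 ≤ k ∧ k ≤ m ∧ 2 ≤ r then (k - 1).choose (r - 1) * (m - k).choose (r - 2)
        else 0) := by
  induction m with
  | zero =>
    intro k r
    have hF : runSets False 0 k r = ∅ := by
      ext B
      rw [mem_runSets]
      simp only [Finset.notMem_empty, iff_false]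
      tauto
    have hT : runSets True 0 k r = if k = 1 ∧ r = 1 then {{0}} else ∅ := by
      have h0 : adjacentPairs {0} = 0 := by decide
      ext B
      rw [mem_runSets]
      have hB : B ⊆ Finset.range (0 + 1) ∧ 0 ∈ B ↔ B = {0} := by
        simp only [zero_add, Finset.range_one, Finset.subset_singleton_iff]
        constructor
        · rintro ⟨rfl | rfl, h⟩
          · simp at h
          · rfl
        · rintro rfl
          simp
      rw [← and_assoc, hB]
      split_ifs with h
      · obtain ⟨rfl, rfl⟩ := h
        simp only [Finset.mem_singleton, and_iff_left_iff_imp]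
        rintro rfl
        simp [h0]
      · simp only [Finset.notMem_empty, iff_false]
        rintro ⟨rfl, -, h1, h2⟩
        simp only [Finset.card_singleton] at h1
        omega
    rw [hF, hT]
    constructor
    · rw [if_neg (by omega)]
      rfl
    · split_ifs <;> first | rfl | omega
  | succ m ih =>
    intro k r
    rcases k with _ | k
    · simp [runSets_zero_card]
    rw [card_runSets_false_succ, card_runSets_true_succ, (ih (k + 1) r).1, (ih (k + 1) r).2,
      (ih k (r - 1)).1, (ih k r).2]
    rcases r with _ | r
    · simp
    simp only [Nat.add_sub_cancel, Nat.succ_ne_zero, if_false]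
    constructor
    · rcases lt_trichotomy (k + 1) (m + 1) with h | h | h
      · obtain ⟨l, rfl⟩ : ∃ l, m = k + 1 + l := ⟨m - (k + 1), by omega⟩
        rw [if_pos (by omega), if_neg (by omega),
          show k + 1 + l - (k + 1) = l by omega, show k + 1 + l + 1 - (k + 1) = l + 1 by omega]
        rcases r with _ | r
        · rw [if_neg (by omega), if_pos (by omega)]
          simp
        · rw [if_pos (by omega), if_pos (by omega),
            Nat.choose_succ_succ l r, show r + 1 + 1 - 2 = r by omega]
          ring
      · obtain rfl : k = m := by omega
        rw [if_neg (by omega), if_pos rfl]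
        rcases r with _ | r <;> simp
      · rw [if_neg (by omega), if_neg (by omega), if_neg (by omega), if_neg (by omega)]
    · rcases lt_trichotomy k (m + 1) with h | h | h
      · obtain ⟨l, rfl⟩ : ∃ l, m = k + l := ⟨m - k, by omega⟩
        rw [if_neg (show ¬ k = k + l + 1 by omega), if_neg (show ¬ k + 1 = k + l + 1 + 1 by omega),
          show k + l + 1 - (k + 1) = l by omega, show k + l - k = l by omega]
        rcases r with _ | r
        · simp
        rcases k with _ | k
        · simp
        rw [if_pos (by omega), if_pos (by omega), if_pos (by omega), Nat.add_sub_cancel,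
          Nat.add_sub_cancel, Nat.choose_succ_succ k r, show r + 1 + 1 - 2 = r by omega]
        ring
      · subst h
        rw [if_neg (by omega), if_pos rfl, if_pos rfl]
        simp
      · rw [if_neg (by omega), if_neg (by omega), if_neg (by omega), if_neg (by omega),
          if_neg (by omega)]

lemma card_filter_mem_sub_notMem {n : ℕ} [NeZero n] (i : ℤ) (A : Finset (ZMod n)) :
    (A.filter (fun b => b - (i : ZMod n) ∉ A)).card + inc n i A = A.card := by
  have h : inc n i A = (A.filter (fun b => b - (i : ZMod n) ∈ A)).card := by
    unfold inc
    refine Finset.card_nbij' (fun a => a + (i : ZMod n)) (fun b => b - (i : ZMod n)) ?_ ?_ ?_ ?_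
    · intro a ha
      simp only [Finset.coe_filter, Set.mem_ofPred_eq] at ha ⊢
      simpa using ha.symm
    · intro a ha
      simp only [Finset.coe_filter, Set.mem_ofPred_eq] at ha ⊢
      simpa using ha.symm
    · intro a _
      simp
    · intro a _
      simp
  rw [h, add_comm]
  exact Finset.card_filter_add_card_filter_not _

lemma card_filter_start_eq_card_runSets {m k x r : ℕ} {i : ℤ} (hi : Int.gcd i (m + 1 : ℕ) = 1)
    (hxr : x + r = k) (b : ZMod (m + 1)) :
    (Finset.univ.filter (fun A : Finset (ZMod (m + 1)) =>
      (A.card = k ∧ inc (m + 1) i A = x) ∧ b ∈ A ∧ b - (i : ZMod (m + 1)) ∉ A)).card =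
      (runSets False m k r).card := by
  have hu : IsUnit (i : ZMod (m + 1)) := by
    rw [ZMod.coe_int_isUnit_iff_isCoprime]
    exact (Int.isCoprime_iff_gcd_eq_one.2 hi).symm
  set φ : ℕ → ZMod (m + 1) := fun t => b + i * t with hφ
  have hinj : Set.InjOn φ (Finset.range (m + 1)) := by
    intro s hs t ht h
    have h1 : (s : ZMod (m + 1)) = t := hu.mul_left_cancel (add_left_cancel h)
    rw [ZMod.natCast_eq_natCast_iff'] at h1
    simp only [Finset.coe_range, Set.mem_Iio] at hs ht
    rwa [Nat.mod_eq_of_lt hs, Nat.mod_eq_of_lt ht] at h1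
  have hsurj : ∀ a, ∃ t < m + 1, φ t = a := by
    intro a
    obtain ⟨c, hc⟩ := hu.exists_right_inv
    refine ⟨(c * (a - b)).val, ZMod.val_lt _, ?_⟩
    simp only [hφ, ZMod.natCast_val, ZMod.cast_id', id_eq]
    rw [← mul_assoc, hc]
    ring
  have hsucc : ∀ t, φ t + i = φ (t + 1) := by
    intro t
    simp only [hφ]
    push_cast
    ring
  have hzero : φ 0 = b := by simp [hφ]
  have hlast : φ m = b - i := by
    have h : φ (m + 1) = b := by
      simp only [hφ, ZMod.natCast_self, mul_zero, add_zero]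
    rw [eq_sub_iff_add_eq, hsucc, h]
  have hmem : ∀ B ⊆ Finset.range (m + 1), ∀ t < m + 1, (φ t ∈ B.image φ ↔ t ∈ B) := by
    intro B hB t ht
    rw [Finset.mem_image]
    constructor
    · rintro ⟨s, hs, h⟩
      rwa [← hinj (hB hs) (Finset.mem_range.2 ht) h]
    · exact fun h => ⟨t, h, rfl⟩
  have hinc : ∀ B ⊆ Finset.range (m + 1), m ∉ B →
      inc (m + 1) i (B.image φ) = adjacentPairs B := by
    intro B hB hm
    unfold inc adjacentPairs
    rw [Finset.filter_image, Finset.card_image_of_injOn]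
    · congr 1
      refine Finset.filter_congr fun t ht => ?_
      have h1 := Finset.mem_range.1 (hB ht)
      have h2 : t ≠ m := fun h => hm (h ▸ ht)
      rw [hsucc, hmem B hB _ (by omega)]
    · exact hinj.mono fun t ht => hB (Finset.mem_filter.1 ht).1
  have hcard : ∀ B ⊆ Finset.range (m + 1), (B.image φ).card = B.card := fun B hB =>
    Finset.card_image_of_injOn (hinj.mono hB)
  symm
  refine Finset.card_bij (fun B _ => B.image φ) ?_ ?_ ?_
  · intro B hB
    obtain ⟨h1, h2, h3, h4, h5⟩ := mem_runSets.1 hB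
    have hm : m ∉ B := by tauto
    rw [Finset.mem_filter, ← hlast, hmem B h1 m (by omega), hcard B h1, hinc B h1 hm]
    refine ⟨Finset.mem_univ _, ⟨h4, by omega⟩, ?_, hm⟩
    rw [← hzero]
    exact Finset.mem_image_of_mem φ h2
  · intro B hB C hC h
    have hB' := (mem_runSets.1 hB).1
    have hC' := (mem_runSets.1 hC).1
    ext t
    by_cases ht : t < m + 1
    · rw [← hmem B hB' t ht, ← hmem C hC' t ht, h]
    · have h1 : t ∉ B := fun h => ht (Finset.mem_range.1 (hB' h))
      have h2 : t ∉ C := fun h => ht (Finset.mem_range.1 (hC' h))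
      tauto
  · intro A hA
    obtain ⟨-, ⟨h1, h2⟩, h3, h4⟩ := Finset.mem_filter.1 hA
    have hs : (Finset.range (m + 1)).filter (fun t => φ t ∈ A) ⊆ Finset.range (m + 1) :=
      Finset.filter_subset _ _
    have himg : ((Finset.range (m + 1)).filter (fun t => φ t ∈ A)).image φ = A := by
      ext a
      simp only [Finset.mem_image, Finset.mem_filter, Finset.mem_range]
      constructor
      · rintro ⟨t, ⟨-, ht⟩, rfl⟩
        exact ht
      · intro ha
        obtain ⟨t, ht, rfl⟩ := hsurj a
        exact ⟨t, ⟨ht, ha⟩, rfl⟩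
    have hm : m ∉ (Finset.range (m + 1)).filter (fun t => φ t ∈ A) := by
      simp [hlast, h4]
    refine ⟨_, mem_runSets.2 ⟨hs, ?_, by simpa using hm, ?_, ?_⟩, himg⟩
    · simp [hzero, h3]
    · rw [← hcard _ hs, himg, h1]
    · rw [← hinc _ hs hm, himg, h2, hxr]

/-- For `n ≥ 3`, `1 ≤ k`, `2k ≤ n`, `gcd(i, n) = 1` and `0 ≤ x ≤ k - 1`:
`(k - x) * |{A : |A| = k, d_i(A) = x}| = n * C(k-1, k-x-1) * C(n-k-1, k-x-1)`. -/
theorem count_dist_i_closed_form (n k x : ℕ) [NeZero n] (hn : 3 ≤ n) (hk : 1 ≤ k)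
    (h2k : 2 * k ≤ n) (i : ℤ) (hi : Int.gcd i n = 1) (hx : x ≤ k - 1) :
    (k - x) *
        (Finset.univ.filter (fun A : Finset (ZMod n) => A.card = k ∧ inc n i A = x)).card =
      n * Nat.choose (k - 1) (k - x - 1) * Nat.choose (n - k - 1) (k - x - 1) := by
  obtain ⟨m, rfl⟩ : ∃ m, n = m + 1 := ⟨n - 1, by omega⟩
  have hleft : ∀ A ∈ Finset.univ.filter
      (fun A : Finset (ZMod (m + 1)) => A.card = k ∧ inc (m + 1) i A = x),
      (Finset.univ.filter
        (fun b : ZMod (m + 1) => b ∈ A ∧ b - (i : ZMod (m + 1)) ∉ A)).card = k - x := by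
    intro A hA
    obtain ⟨-, h1, h2⟩ := Finset.mem_filter.1 hA
    have h := card_filter_mem_sub_notMem i A
    have hset : Finset.univ.filter
        (fun b : ZMod (m + 1) => b ∈ A ∧ b - (i : ZMod (m + 1)) ∉ A) =
        A.filter (fun b => b - (i : ZMod (m + 1)) ∉ A) := by
      ext b
      simp
    rw [hset]
    omega
  have hright : ∀ b ∈ (Finset.univ : Finset (ZMod (m + 1))),
      ((Finset.univ.filter
        (fun A : Finset (ZMod (m + 1)) => A.card = k ∧ inc (m + 1) i A = x)).filter
        (fun A => b ∈ A ∧ b - (i : ZMod (m + 1)) ∉ A)).card =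
      (k - 1).choose (k - x - 1) * (m - k).choose (k - x - 1) := by
    intro b _
    rw [Finset.filter_filter,
      card_filter_start_eq_card_runSets hi (show x + (k - x) = k by omega) b,
      (card_runSets m k (k - x)).1, if_pos (by omega)]
  have hcount := Finset.sum_card_bipartiteAbove_eq_sum_card_bipartiteBelow
    (s := Finset.univ.filter
      (fun A : Finset (ZMod (m + 1)) => A.card = k ∧ inc (m + 1) i A = x))
    (t := Finset.univ) (fun A b => b ∈ A ∧ b - (i : ZMod (m + 1)) ∉ A)
  unfold Finset.bipartiteAbove Finset.bipartiteBelow at hcount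
  rw [Finset.sum_congr rfl hleft, Finset.sum_congr rfl hright, Finset.sum_const,
    Finset.sum_const, Finset.card_univ, ZMod.card, smul_eq_mul, smul_eq_mul] at hcount
  rw [mul_comm, hcount, show m + 1 - k - 1 = m - k by omega, mul_assoc]
end

section
/- Let n ≥ 3 be odd, let k = (n−1)/2, let i be an integer with gcd(i, n) = 1, and let 0 ≤ x ≤ k−1. Then (k − x) · |{A ⊆ ℤ/nℤ : |A| = k and d_i(A) = x}| = (2k+1) · C(k−1, k−x−1) · C(k, k−x−1); that is, the number of such subsets equals n times the Narayana number N(k, x) = (1/(k−x)) C(k−1, k−x−1) C(k, k−x−1). -/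
/-- The number of maximal runs of consecutive integers in `B`, counted by their last elements. -/
def runs (B : Finset ℕ) : ℕ := (B.filter (fun j => j + 1 ∉ B)).card

/-- Subsets of `{0, …, m}` with `a` elements and `r` runs that contain `0` and contain `m`. -/
def setsEndingIn (m a r : ℕ) : Finset (Finset ℕ) :=
  (Finset.range (m + 1)).powerset.filter
    (fun B => 0 ∈ B ∧ m ∈ B ∧ B.card = a ∧ runs B = r)

/-- Subsets of `{0, …, m}` with `a` elements and `r` runs that contain `0` but not `m`. -/
def setsEndingOut (m a r : ℕ) : Finset (Finset ℕ) :=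
  (Finset.range (m + 1)).powerset.filter
    (fun B => 0 ∈ B ∧ m ∉ B ∧ B.card = a ∧ runs B = r)

theorem runs_pos {B : Finset ℕ} (hB : B.Nonempty) : 0 < runs B := by
  refine Finset.card_pos.2 ⟨B.max' hB, Finset.mem_filter.2 ⟨B.max'_mem hB, fun h => ?_⟩⟩
  have := B.le_max' _ h
  omega

theorem runs_insert_of_mem {B : Finset ℕ} {m : ℕ} (hB : B ⊆ Finset.range (m + 1)) (hm : m ∈ B) :
    runs (insert (m + 1) B) = runs B := by
  unfold runs
  have hlt : ∀ j ∈ B, j < m + 1 := fun j hj => Finset.mem_range.1 (hB hj)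
  refine Finset.card_nbij' (fun j => if j = m + 1 then m else j)
    (fun j => if j = m then m + 1 else j) ?_ ?_ ?_ ?_ <;>
  · intro j hj
    have := hlt j
    have := hlt (j + 1)
    have := hlt (m + 1)
    have := hlt (m + 2)
    simp only [Finset.coe_filter, Finset.mem_insert, Set.mem_ofPred_eq] at hj ⊢
    grind

theorem runs_insert_of_notMem {B : Finset ℕ} {m : ℕ} (hB : B ⊆ Finset.range (m + 1))
    (hm : m ∉ B) : runs (insert (m + 1) B) = runs B + 1 := by
  unfold runs
  have hlt : ∀ j ∈ B, j < m + 1 := fun j hj => Finset.mem_range.1 (hB hj)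
  rw [← Finset.card_insert_of_notMem (a := m + 1) (s := B.filter (fun j => j + 1 ∉ B))]
  · congr 1
    ext j
    have := hlt j
    have := hlt (j + 1)
    have := hlt (m + 1)
    have := hlt (m + 2)
    simp only [Finset.mem_filter, Finset.mem_insert]
    grind
  · intro h
    have := hlt _ (Finset.mem_filter.1 h).1
    omega

theorem card_setsEndingOut_succ (m a r : ℕ) :
    (setsEndingOut (m + 1) a r).card = (setsEndingOut m a r).card + (setsEndingIn m a r).card := by
  rw [← Finset.card_union_of_disjoint]
  · congr 1
    ext B
    simp only [setsEndingOut, setsEndingIn, Finset.mem_union, Finset.mem_filter,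
      Finset.mem_powerset, Finset.range_add_one (n := m + 1)]
    constructor
    · rintro ⟨h, h0, hm, hc⟩
      rw [Finset.subset_insert_iff_of_notMem hm] at h
      tauto
    · rintro (⟨h, h0, -, hc⟩ | ⟨h, h0, -, hc⟩) <;>
      exact ⟨h.trans (Finset.subset_insert _ _), h0, fun hm => by simpa using h hm, hc⟩
  · rw [Finset.disjoint_left]
    intro B h h'
    exact (Finset.mem_filter.1 h).2.2.1 (Finset.mem_filter.1 h').2.2.1

theorem card_setsEndingIn_succ (m a r : ℕ) :
    (setsEndingIn (m + 1) (a + 1) (r + 1)).card =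
      (setsEndingOut m a r).card + (setsEndingIn m a (r + 1)).card := by
  rw [← Finset.card_union_of_disjoint]
  · symm
    have hsub : ∀ B ∈ setsEndingOut m a r ∪ setsEndingIn m a (r + 1),
        B ⊆ Finset.range (m + 1) := by
      intro B hB
      simp only [setsEndingOut, setsEndingIn, Finset.mem_union, Finset.mem_filter,
        Finset.mem_powerset] at hB
      tauto
    have hnot : ∀ B : Finset ℕ, B ⊆ Finset.range (m + 1) → m + 1 ∉ B :=
      fun B h hm => by simpa using h hm
    refine Finset.card_nbij' (fun B => insert (m + 1) B) (fun B => B.erase (m + 1)) ?_ ?_ ?_ ?_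
    · intro B hB
      have hs := hsub B hB
      have hn := hnot B hs
      simp only [setsEndingOut, setsEndingIn, Finset.coe_union, Set.mem_union, Finset.mem_coe,
        Finset.mem_filter, Finset.mem_powerset] at hB ⊢
      rw [Finset.card_insert_of_notMem hn, Finset.range_add_one (n := m + 1)]
      refine ⟨Finset.insert_subset_insert _ hs, ?_⟩
      rcases hB with ⟨-, h0, hm, hc, hr⟩ | ⟨-, h0, hm, hc, hr⟩
      · rw [runs_insert_of_notMem hs hm]; simp [h0, hc, hr]
      · rw [runs_insert_of_mem hs hm]; simp [h0, hc, hr]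
    · intro B hB
      simp only [setsEndingOut, setsEndingIn, Finset.coe_union, Set.mem_union, Finset.mem_coe,
        Finset.mem_filter, Finset.mem_powerset] at hB ⊢
      obtain ⟨hs, h0, hm, hc, hr⟩ := hB
      have hs' : B.erase (m + 1) ⊆ Finset.range (m + 1) := by
        rwa [Finset.range_add_one (n := m + 1), Finset.subset_insert_iff] at hs
      have hc' : (B.erase (m + 1)).card = a := by
        rw [Finset.card_erase_of_mem hm, hc]; rfl
      have h0' : 0 ∈ B.erase (m + 1) := Finset.mem_erase.2 ⟨by omega, h0⟩
      by_cases h : m ∈ B.erase (m + 1)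
      · have := runs_insert_of_mem hs' h
        rw [Finset.insert_erase hm] at this
        exact Or.inr ⟨hs', h0', h, hc', by omega⟩
      · have := runs_insert_of_notMem hs' h
        rw [Finset.insert_erase hm] at this
        exact Or.inl ⟨hs', h0', h, hc', by omega⟩
    · intro B hB
      exact Finset.erase_insert (hnot B (hsub B hB))
    · intro B hB
      exact Finset.insert_erase (Finset.mem_filter.1 hB).2.2.1
  · rw [Finset.disjoint_left]
    intro B h h'
    exact (Finset.mem_filter.1 h).2.2.1 (Finset.mem_filter.1 h').2.2.1

theorem setsEndingIn_card_zero (m r : ℕ) : setsEndingIn m 0 r = ∅ := by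
  refine Finset.filter_eq_empty_iff.2 fun B _ h => ?_
  rw [Finset.card_eq_zero] at h
  simp [h.2.2.1] at h

theorem setsEndingOut_card_zero (m r : ℕ) : setsEndingOut m 0 r = ∅ := by
  refine Finset.filter_eq_empty_iff.2 fun B _ h => ?_
  rw [Finset.card_eq_zero] at h
  simp [h.2.2.1] at h

theorem setsEndingOut_runs_zero (m a : ℕ) : setsEndingOut m a 0 = ∅ := by
  refine Finset.filter_eq_empty_iff.2 fun B _ h => ?_
  exact (runs_pos ⟨0, h.1⟩).ne' h.2.2.2

theorem setsEndingOut_eq_empty {m a r : ℕ} (h : m < a) : setsEndingOut m a r = ∅ := by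
  refine Finset.filter_eq_empty_iff.2 fun B hB hB' => ?_
  have hs : B ⊆ Finset.range m := by
    have := Finset.mem_powerset.1 hB
    rwa [Finset.range_add_one, Finset.subset_insert_iff_of_notMem hB'.2.1] at this
  have := Finset.card_le_card hs
  rw [Finset.card_range, hB'.2.2.1] at this
  omega

theorem card_setsEndingIn_zero (r : ℕ) :
    (setsEndingIn 0 1 (r + 1)).card = if r = 0 then 1 else 0 := by
  have : setsEndingIn 0 1 (r + 1) = if r = 0 then {{0}} else ∅ := by
    ext B
    have hr : runs {0} = 1 := by decide
    have hB : B ⊆ {0} ∧ 0 ∈ B ↔ B = {0} := by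
      constructor
      · rintro ⟨h, h0⟩
        exact h.antisymm (by simpa using h0)
      · rintro rfl
        simp
    simp only [setsEndingIn, Finset.mem_filter, Finset.mem_powerset, zero_add, Finset.range_one]
    constructor
    · rintro ⟨h, h0, -, -, h1⟩
      obtain rfl := hB.1 ⟨h, h0⟩
      have : r = 0 := by omega
      simp [this]
    · intro h
      split_ifs at h with h0
      · obtain rfl := Finset.mem_singleton.1 h
        simp [hr, h0]
      · simp at h
  rw [this]
  split_ifs <;> rfl

theorem card_setsEnding (m : ℕ) :
    (∀ a b r, a + b + 1 = m →
      (setsEndingOut m (a + 1) (r + 1)).card = a.choose r * b.choose r) ∧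
    (∀ a r, a = m → (setsEndingIn m (a + 1) (r + 1)).card = if r = 0 then 1 else 0) ∧
    (∀ a b, a + b + 1 = m → (setsEndingIn m (a + 1) 1).card = 0) ∧
    (∀ a b r, a + b + 1 = m →
      (setsEndingIn m (a + 1) (r + 2)).card = a.choose (r + 1) * b.choose r) := by
  induction m with
  | zero =>
    refine ⟨fun a b r h => by omega, ?_, fun a b h => by omega, fun a b r h => by omega⟩
    rintro a r rfl
    exact card_setsEndingIn_zero r
  | succ m ih =>
    obtain ⟨ihO, ihF, ihOne, ihI⟩ := ih
    refine ⟨fun a b r h => ?_, fun a r h => ?_, fun a b h => ?_, fun a b r h => ?_⟩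
    · rw [card_setsEndingOut_succ]
      rcases b with _ | b
      · rw [setsEndingOut_eq_empty (by omega), ihF a r (by omega)]
        rcases r with _ | r <;> simp
      · rw [ihO a b r (by omega)]
        rcases r with _ | r
        · rw [ihOne a b (by omega)]; simp
        · rw [ihI a b r (by omega), Nat.choose_succ_succ b r]; ring
    · subst h
      rw [card_setsEndingIn_succ, setsEndingOut_eq_empty (by omega), ihF m r rfl]
      simp
    · rw [card_setsEndingIn_succ, setsEndingOut_runs_zero]
      rcases a with _ | a
      · rw [setsEndingIn_card_zero]; simp
      · rw [ihOne a b (by omega)]; simp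
    · rw [card_setsEndingIn_succ]
      rcases a with _ | a
      · rw [setsEndingOut_card_zero, setsEndingIn_card_zero]; simp
      · rw [ihO a b r (by omega), ihI a b r (by omega), Nat.choose_succ_succ a r]; ring

theorem card_filter_add_notMem {n : ℕ} (i : ℤ) (A : Finset (ZMod n)) :
    (A.filter (fun t => t + (i : ZMod n) ∉ A)).card + inc n i A = A.card := by
  rw [add_comm]
  exact Finset.card_filter_add_card_filter_not _

theorem card_filter_sub_notMem {n : ℕ} (i : ℤ) (A : Finset (ZMod n)) :
    (A.filter (fun t => t - (i : ZMod n) ∉ A)).card + inc n i A = A.card := by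
  have h : inc n i A = (A.filter (fun t => t - (i : ZMod n) ∈ A)).card := by
    refine Finset.card_nbij' (fun t => t + (i : ZMod n)) (fun t => t - (i : ZMod n)) ?_ ?_ ?_ ?_ <;>
    · intro t ht
      simp_all
  rw [h, add_comm]
  exact Finset.card_filter_add_card_filter_not _

section Transfer

variable {n : ℕ} [NeZero n] {i : ℤ}

theorem bijOn_range_add_mul (hi : Int.gcd i n = 1) (s : ZMod n) :
    Set.BijOn (fun j : ℕ => s + (i : ZMod n) * j) (Finset.range n) Set.univ := by
  have hu : IsUnit (i : ZMod n) := by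
    rw [ZMod.coe_int_isUnit_iff_isCoprime]
    exact (Int.isCoprime_iff_gcd_eq_one.2 hi).symm
  refine ⟨fun _ _ => trivial, ?_, ?_⟩
  · intro a ha b hb hab
    have h := hu.mul_left_cancel (add_left_cancel hab)
    rw [ZMod.natCast_eq_natCast_iff'] at h
    rwa [Nat.mod_eq_of_lt (by simpa using ha), Nat.mod_eq_of_lt (by simpa using hb)] at h
  · intro t _
    obtain ⟨c, hc⟩ := hu.exists_right_inv
    refine ⟨(c * (t - s)).val, by simpa using ZMod.val_lt _, ?_⟩
    simp only [ZMod.natCast_val, ZMod.cast_id', id_eq]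
    rw [← mul_assoc, hc]
    ring

theorem card_filter_range_add_mul (hi : Int.gcd i n = 1) (s : ZMod n) (P : ZMod n → Prop)
    [DecidablePred P] :
    ((Finset.range n).filter (fun j : ℕ => P (s + (i : ZMod n) * j))).card =
      (Finset.univ.filter P).card := by
  obtain ⟨-, hinj, hsurj⟩ := bijOn_range_add_mul hi s
  refine Finset.card_nbij (fun j : ℕ => s + (i : ZMod n) * j) ?_ ?_ ?_
  · intro j hj
    simpa using (Finset.mem_filter.1 hj).2
  · exact hinj.mono (Finset.coe_subset.2 (Finset.filter_subset _ _))
  · intro t ht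
    obtain ⟨j, hj, rfl⟩ := hsurj (Set.mem_univ t)
    exact ⟨j, Finset.mem_filter.2 ⟨hj, by simpa using ht⟩, rfl⟩

/-- The positions `j < n` at which the progression `s, s + i, s + 2i, …` meets `A`. -/
def positions (i : ℤ) (s : ZMod n) (A : Finset (ZMod n)) : Finset ℕ :=
  (Finset.range n).filter (fun j : ℕ => s + (i : ZMod n) * j ∈ A)

theorem card_positions (hi : Int.gcd i n = 1) (s : ZMod n) (A : Finset (ZMod n)) :
    (positions i s A).card = A.card := by
  rw [positions, card_filter_range_add_mul hi s (fun t => t ∈ A)]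
  simp

theorem zero_mem_positions {s : ZMod n} {A : Finset (ZMod n)} :
    0 ∈ positions i s A ↔ s ∈ A := by
  simp [positions, Nat.pos_of_ne_zero (NeZero.ne n)]

theorem last_mem_positions {s : ZMod n} {A : Finset (ZMod n)} :
    n - 1 ∈ positions i s A ↔ s - (i : ZMod n) ∈ A := by
  have hn : 1 ≤ n := Nat.pos_of_ne_zero (NeZero.ne n)
  have h : n - 1 < n := by omega
  simp [positions, Nat.cast_sub hn, h, sub_eq_add_neg]

theorem runs_positions (hi : Int.gcd i n = 1) {s : ZMod n} {A : Finset (ZMod n)}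
    (hs : s - (i : ZMod n) ∉ A) :
    runs (positions i s A) + inc n i A = A.card := by
  rw [← card_filter_add_notMem i A]
  congr 1
  have h := card_filter_range_add_mul hi s (fun t => t ∈ A ∧ t + (i : ZMod n) ∉ A)
  have hA : Finset.univ.filter (fun t => t ∈ A ∧ t + (i : ZMod n) ∉ A) =
      A.filter (fun t => t + (i : ZMod n) ∉ A) := by
    ext t; simp
  rw [hA] at h
  rw [← h, runs]
  congr 1
  ext j
  have hlast : j ∈ positions i s A → j + 1 < n := by
    intro hj
    have hjn := Finset.mem_range.1 (Finset.mem_filter.1 hj).1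
    by_contra hcon
    obtain rfl : j = n - 1 := by omega
    exact hs (last_mem_positions.1 hj)
  have hstep : s + (i : ZMod n) * ((j + 1 : ℕ) : ZMod n) = s + i * j + i := by
    push_cast; ring
  by_cases hj : j ∈ positions i s A
  · have hlt := hlast hj
    have hj' := Finset.mem_filter.1 hj
    have hsucc : j + 1 ∈ positions i s A ↔ s + (i : ZMod n) * j + i ∈ A := by
      rw [← hstep]
      simp only [positions, Finset.mem_filter, Finset.mem_range, hlt, true_and]
    rw [Finset.mem_filter, Finset.mem_filter, hsucc]
    tauto
  · have hj' := hj
    simp only [positions, Finset.mem_filter] at hj'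
    simp only [Finset.mem_filter]
    tauto

theorem card_starting_at (hi : Int.gcd i n = 1) (s : ZMod n) {k x : ℕ} (hx : x ≤ k) :
    (Finset.univ.filter (fun A : Finset (ZMod n) =>
      (A.card = k ∧ inc n i A = x) ∧ s ∈ A ∧ s - (i : ZMod n) ∉ A)).card =
      (setsEndingOut (n - 1) k (k - x)).card := by
  have hn : n - 1 + 1 = n := Nat.sub_add_cancel (Nat.pos_of_ne_zero (NeZero.ne n))
  obtain ⟨-, hinj, hsurj⟩ := bijOn_range_add_mul hi s
  refine Finset.card_nbij (positions i s) ?_ ?_ ?_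
  · intro A hA
    obtain ⟨⟨hc, hinc⟩, h0, hl⟩ := (Finset.mem_filter.1 hA).2
    have hr := runs_positions hi hl
    refine Finset.mem_filter.2 ⟨?_, zero_mem_positions.2 h0, mt last_mem_positions.1 hl,
      by rw [card_positions hi, hc], by omega⟩
    rw [hn]
    exact Finset.mem_powerset.2 (Finset.filter_subset _ _)
  · intro A _ A' _ h
    ext t
    obtain ⟨j, hj, rfl⟩ := hsurj (Set.mem_univ t)
    have := Finset.ext_iff.1 h j
    simp only [positions, Finset.mem_filter] at this
    simpa [Finset.mem_coe.1 hj] using this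
  · intro B hB
    obtain ⟨hsub, h0, hl, hc, hr⟩ := Finset.mem_filter.1 hB
    rw [hn, Finset.mem_powerset] at hsub
    set A := B.image (fun j : ℕ => s + (i : ZMod n) * j) with hA
    have hpos : positions i s A = B := by
      ext j
      simp only [positions, hA, Finset.mem_filter, Finset.mem_image]
      constructor
      · rintro ⟨hj, j', hj', h⟩
        exact hinj (hsub hj') hj h ▸ hj'
      · exact fun hj => ⟨hsub hj, j, hj, rfl⟩
    have hlA : s - (i : ZMod n) ∉ A := by rwa [← last_mem_positions, hpos]
    have hcA : A.card = k := by rw [← card_positions hi s, hpos, hc]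
    have hrA := runs_positions hi hlA
    rw [hpos] at hrA
    exact ⟨A, Finset.mem_filter.2 ⟨Finset.mem_univ _, ⟨hcA, by omega⟩,
      zero_mem_positions.1 (hpos ▸ h0), hlA⟩, hpos⟩

/-- Double counting of pairs of a set and the first element of one of its runs. -/
theorem mul_card_filter_inc (hi : Int.gcd i n = 1) {k x : ℕ} (hx : x ≤ k) :
    (k - x) *
        (Finset.univ.filter (fun A : Finset (ZMod n) => A.card = k ∧ inc n i A = x)).card =
      n * (setsEndingOut (n - 1) k (k - x)).card := by
  have h := Finset.sum_card_bipartiteAbove_eq_sum_card_bipartiteBelow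
    (s := Finset.univ.filter (fun A : Finset (ZMod n) => A.card = k ∧ inc n i A = x))
    (t := Finset.univ) (fun A (s : ZMod n) => s ∈ A ∧ s - (i : ZMod n) ∉ A)
  rw [Finset.sum_const_nat (m := k - x), Finset.sum_const_nat
    (m := (setsEndingOut (n - 1) k (k - x)).card), Finset.card_univ, ZMod.card] at h
  · rw [mul_comm, h]
  · intro s _
    rw [← card_starting_at hi s hx, Finset.bipartiteBelow, Finset.filter_filter]
  · intro A hA
    obtain ⟨hc, hinc⟩ := (Finset.mem_filter.1 hA).2
    have hsub := card_filter_sub_notMem i A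
    have hA' : Finset.univ.bipartiteAbove
        (fun A (s : ZMod n) => s ∈ A ∧ s - (i : ZMod n) ∉ A) A =
        A.filter (fun t => t - (i : ZMod n) ∉ A) := by
      ext t; simp [Finset.bipartiteAbove]
    rw [hA']
    omega

end Transfer

/-- For `n ≥ 3` odd, `k = (n-1)/2`, `gcd(i, n) = 1` and `0 ≤ x ≤ k - 1`:
`(k - x) * |{A : |A| = k, d_i(A) = x}| = (2k+1) * C(k-1, k-x-1) * C(k, k-x-1)`,
i.e. the count is `n` times the Narayana number `N(k, x)`. -/
theorem count_dist_i_narayana (n k x : ℕ) [NeZero n] (hn : 3 ≤ n) (hodd : Odd n)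
    (hk : k = (n - 1) / 2) (i : ℤ) (hi : Int.gcd i n = 1) (hx : x ≤ k - 1) :
    (k - x) *
        (Finset.univ.filter (fun A : Finset (ZMod n) => A.card = k ∧ inc n i A = x)).card =
      (2 * k + 1) * Nat.choose (k - 1) (k - x - 1) * Nat.choose k (k - x - 1) := by
  obtain ⟨q, hq⟩ := hodd
  obtain ⟨a, rfl⟩ : ∃ a, k = a + 1 := ⟨k - 1, by omega⟩
  obtain ⟨r, hr⟩ : ∃ r, a + 1 - x = r + 1 := ⟨a - x, by omega⟩
  rw [mul_card_filter_inc hi (by omega), hr,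
    (card_setsEnding (n - 1)).1 a (a + 1) r (by omega), mul_assoc]
  congr 1
  omega
end

section
/- Let n ≥ 3, let 1 ≤ k with 2k ≤ n and gcd(n, k) = 1, let i be an integer with gcd(i, n) = 1, and let 0 ≤ x ≤ k−1. Then there exists a k-element subset A of ℤ/nℤ with d_i(A) = x; that is, the count |{A ⊆ ℤ/nℤ : |A| = k and d_i(A) = x}| is strictly positive. -/
/-- For `n ≥ 3`, `1 ≤ k`, `2k ≤ n`, `gcd(n, k) = 1`, `gcd(i, n) = 1` and `0 ≤ x ≤ k-1`,
there exists a `k`-subset `A` of `ℤ/nℤ` with `d_i(A) = x`; the count is positive. -/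
theorem exists_subset_with_inc (n k x : ℕ) [NeZero n] (hn : 3 ≤ n) (hk : 1 ≤ k)
    (h2k : 2 * k ≤ n) (hcop : Nat.gcd n k = 1) (i : ℤ) (hi : Int.gcd i n = 1)
    (hx : x ≤ k - 1) :
    (∃ A : Finset (ZMod n), A.card = k ∧ inc n i A = x) ∧
    0 < (Finset.univ.filter
          (fun A : Finset (ZMod n) => A.card = k ∧ inc n i A = x)).card := by
  suffices h : ∃ A : Finset (ZMod n), A.card = k ∧ inc n i A = x by
    refine ⟨h, ?_⟩
    obtain ⟨A, hA⟩ := h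
    exact Finset.card_pos.mpr ⟨A, by simpa using hA⟩
  have hunit : IsUnit (i : ZMod n) :=
    (ZMod.coe_int_isUnit_iff_isCoprime i n).mpr (Int.isCoprime_iff_gcd_eq_one.mpr hi).symm
  have hinj : ∀ a b : ℕ, a < n → b < n →
      ((a : ZMod n) * (i : ZMod n) = (b : ZMod n) * (i : ZMod n) ↔ a = b) := by
    intro a b ha hb
    rw [hunit.mul_left_inj, ZMod.natCast_eq_natCast_iff', Nat.mod_eq_of_lt ha,
      Nat.mod_eq_of_lt hb]
  -- A run of `x + 1` consecutive multiples of `i`, followed by `k - x - 1` isolated ones.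
  let g : ℕ → ZMod n := fun j => ((j + (j - x) : ℕ) : ZMod n) * (i : ZMod n)
  have hg : Set.InjOn g (Finset.range k) := by
    intro a ha b hb hab
    simp only [Finset.coe_range, Set.mem_Iio] at ha hb
    have := (hinj _ _ (by omega) (by omega)).mp hab
    omega
  refine ⟨(Finset.range k).image g, by simp [Finset.card_image_of_injOn hg], ?_⟩
  have hstep : ∀ j < k, (g j + (i : ZMod n) ∈ (Finset.range k).image g ↔ j < x) := by
    intro j hj
    have hsucc : g j + (i : ZMod n) = ((j + (j - x) + 1 : ℕ) : ZMod n) * (i : ZMod n) := by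
      simp only [g]
      push_cast
      ring
    rw [hsucc, Finset.mem_image]
    constructor
    · rintro ⟨l, hl, h⟩
      rw [Finset.mem_range] at hl
      have := (hinj _ _ (by omega) (by omega)).mp h
      omega
    · intro hjx
      refine ⟨j + 1, Finset.mem_range.mpr (by omega), ?_⟩
      exact (hinj _ _ (by omega) (by omega)).mpr (by omega)
  have hfilter : (Finset.range k).filter
      (fun j => g j + (i : ZMod n) ∈ (Finset.range k).image g) = Finset.range x := by
    ext j
    rw [Finset.mem_filter, Finset.mem_range, Finset.mem_range]
    constructor
    · rintro ⟨hj, h⟩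
      exact (hstep j hj).mp h
    · intro hj
      have hjk : j < k := by omega
      exact ⟨hjk, (hstep j hjk).mpr hj⟩
  rw [inc, Finset.filter_image, hfilter, Finset.card_image_of_injOn, Finset.card_range]
  exact hg.mono (by simp only [Finset.coe_range]; exact Set.Iio_subset_Iio (by omega))
end

section
/- Let k ≥ 1 and n = 2k + 1. Then the number of orbits of the translation action of ℤ/nℤ on the k-element subsets of ℤ/nℤ equals the k-th Catalan number C_k = (1/(k+1))·C(2k, k); equivalently, (1/(2k+1))·C(2k+1, k) = C_k. -/
namespace Finset

variable {G : Type*} [AddCommGroup G] [DecidableEq G]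

theorem image_add_right_add (A : Finset G) (s t : G) :
    (A.image (· + s)).image (· + t) = A.image (· + (s + t)) := by
  simp only [image_image, Function.comp_def, add_assoc]

variable [Fintype G]

/-- A set whose size is coprime to the order of the group has pairwise distinct translates. -/
theorem image_add_right_injective_of_coprime {A : Finset G}
    (h : A.card.Coprime (Fintype.card G)) :
    Function.Injective fun t : G => A.image (· + t) := by
  intro s t hst
  have hsum (u : G) : ∑ x ∈ A.image (· + u), x = ∑ x ∈ A, x + A.card • u := by
    rw [sum_image (fun _ _ _ _ => add_right_cancel), sum_add_distrib, sum_const]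
  have heq : A.card • s = A.card • t :=
    add_left_cancel (by rw [← hsum s, ← hsum t]; exact congrArg (fun B => ∑ x ∈ B, x) hst)
  have hzero : A.card • (s - t) = 0 := by rw [smul_sub, heq, sub_self]
  have hdvd := Nat.dvd_gcd (addOrderOf_dvd_of_nsmul_eq_zero hzero)
    (addOrderOf_dvd_card (x := s - t))
  rw [h.gcd_eq_one, Nat.dvd_one, AddMonoid.addOrderOf_eq_one_iff] at hdvd
  exact sub_eq_zero.mp hdvd

theorem image_translates_eq_iff {A B : Finset G} :
    (univ.image fun t : G => B.image (· + t)) = univ.image (fun t : G => A.image (· + t)) ↔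
      B ∈ univ.image fun t : G => A.image (· + t) := by
  constructor
  · intro h
    rw [← h, mem_image]
    exact ⟨0, mem_univ _, by simp⟩
  · simp only [mem_image, mem_univ, true_and]
    rintro ⟨s, rfl⟩
    ext C
    simp only [mem_image, mem_univ, true_and, image_add_right_add]
    constructor
    · rintro ⟨t, rfl⟩
      exact ⟨s + t, rfl⟩
    · rintro ⟨t, rfl⟩
      exact ⟨t - s, by rw [add_sub_cancel]⟩

/-- If `k` is coprime to the order of `G`, translation acts freely on the `k`-subsets of `G`. -/
theorem card_mul_card_translation_orbits {k : ℕ} (h : k.Coprime (Fintype.card G)) :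
    Fintype.card G * ((univ.filter fun A : Finset G => A.card = k).image
      fun A => univ.image fun t : G => A.image fun a => a + t).card =
        (Fintype.card G).choose k := by
  have hcard : (univ.filter fun A : Finset G => A.card = k).card = (Fintype.card G).choose k := by
    rw [← card_univ, ← card_powersetCard, ← powerset_univ, powersetCard_eq_filter]
  rw [← hcard, mul_comm,
    card_eq_sum_card_image fun A : Finset G => univ.image fun t : G => A.image fun a => a + t]
  refine (sum_const_nat fun O hO => ?_).symm
  obtain ⟨A, hA, rfl⟩ := mem_image.mp hO
  obtain rfl := (mem_filter.mp hA).2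
  have hfiber : ((univ.filter fun B : Finset G => B.card = A.card).filter fun B =>
      (univ.image fun t : G => B.image (· + t)) = univ.image fun t : G => A.image (· + t)) =
        univ.image fun t : G => A.image (· + t) := by
    ext B
    rw [mem_filter, image_translates_eq_iff, and_iff_right_iff_imp]
    intro hB
    obtain ⟨t, -, rfl⟩ := mem_image.mp hB
    exact mem_filter.mpr ⟨mem_univ _, card_image_of_injective _ (add_left_injective t)⟩
  rw [hfiber, card_image_of_injective _ (image_add_right_injective_of_coprime h), card_univ]

end Finset

theorem choose_two_mul_add_one_eq_mul_catalan (k : ℕ) :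
    Nat.choose (2 * k + 1) k = (2 * k + 1) * catalan k := by
  have h := Nat.add_one_mul_choose_eq (2 * k) k
  have hc := succ_mul_catalan_eq_centralBinom k
  rw [Nat.centralBinom_eq_two_mul_choose] at hc
  rw [← hc, Nat.choose_symm_half] at h
  apply Nat.eq_of_mul_eq_mul_right k.succ_pos
  rw [Nat.succ_eq_add_one, ← h]
  ring

/-- For `k ≥ 1` and `n = 2k + 1`, the number of orbits of the translation action of
`ℤ/nℤ` on `k`-subsets of `ℤ/nℤ` equals the `k`-th Catalan number;
equivalently `C(2k+1, k) = (2k+1) * catalan k`. -/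
theorem orbit_count_eq_catalan (k : ℕ) (hk : 1 ≤ k) :
    ((Finset.univ.filter (fun A : Finset (ZMod (2 * k + 1)) => A.card = k)).image
        (fun A => Finset.univ.image
          (fun t : ZMod (2 * k + 1) => A.image (fun a => a + t)))).card = catalan k ∧
    Nat.choose (2 * k + 1) k = (2 * k + 1) * catalan k := by
  have hchoose := choose_two_mul_add_one_eq_mul_catalan k
  refine ⟨?_, hchoose⟩
  have hcop : k.Coprime (Fintype.card (ZMod (2 * k + 1))) := by
    rw [ZMod.card]
    simp
  have h := Finset.card_mul_card_translation_orbits hcop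
  rw [ZMod.card, hchoose] at h
  exact Nat.eq_of_mul_eq_mul_left (2 * k).succ_pos h
end
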